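/- Let N ≥ 1 be an integer, Ω ⊂ ℝ^N a bounded smooth domain, p > 1, and let t₀ = √(2p/(p+1)) + √(2p/(p+1) − √(2p/(p+1))) and let s₀ be the unique root in (2t₀, ∞) of L(s) = s⁴ − (32p/(p+1))s² + (32p(p+3)/(p+1)²)s − 64p/(p+1)². Fix s with 2 ≤ s < s₀ and set q = (p+1)s/2 − 1. Then there exists a constant C > 0, depending only on p, s and Ω (in particular independent of λ and u), such that: for every λ > 0 and every u ∈ C⁴(Ω̄) with u ≥ 0, Δ(Δu) = λ(u+1)^p in Ω, u = Δu = 0 on ∂Ω, which satisfies the stability inequality √(λp) ∫_Ω (u+1)^{(p−1)/2} φ² dx ≤ ∫_Ω |∇φ|² dx for all φ ∈ C_c^∞(Ω), one has ∫_Ω (u+1)^{(p−1)/2} u^{q+1} dx ≤ C. -/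

import Mathlib

open MeasureTheory Real

/-- The Laplacian of a function on `ℝ^N` (sum of pure second derivatives). -/
noncomputable def lap {N : ℕ} (u : EuclideanSpace ℝ (Fin N) → ℝ)
    (x : EuclideanSpace ℝ (Fin N)) : ℝ :=
  ∑ i : Fin N, fderiv ℝ (fun y => fderiv ℝ u y (EuclideanSpace.single i 1)) x
    (EuclideanSpace.single i 1)
/-- The dot product of the gradients of two functions on `ℝ^N`. -/
noncomputable def gradDot {N : ℕ} (f g : EuclideanSpace ℝ (Fin N) → ℝ)
    (x : EuclideanSpace ℝ (Fin N)) : ℝ :=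
  ∑ i : Fin N, fderiv ℝ f x (EuclideanSpace.single i 1) *
    fderiv ℝ g x (EuclideanSpace.single i 1)

/-- The quartic polynomial `L`. -/
noncomputable def Lpoly (p s : ℝ) : ℝ :=
  s ^ 4 - 32 * p / (p + 1) * s ^ 2 + 32 * p * (p + 3) / (p + 1) ^ 2 * s
    - 64 * p / (p + 1) ^ 2

/-- `t₀ = √(2p/(p+1)) + √(2p/(p+1) − √(2p/(p+1)))`. -/
noncomputable def t0 (p : ℝ) : ℝ :=
  Real.sqrt (2 * p / (p + 1)) +
    Real.sqrt (2 * p / (p + 1) - Real.sqrt (2 * p / (p + 1)))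

open Filter Topology

/-- The truncated power `t ↦ (max t 0) ^ β` is differentiable for `β > 1`. -/
lemma hasDerivAt_max_zero_rpow {β : ℝ} (hβ : 1 < β) (t : ℝ) :
    HasDerivAt (fun t : ℝ => (max t 0) ^ β) (β * (max t 0) ^ (β - 1)) t := by
  have hβ0 : β ≠ 0 := by linarith
  have hβ1 : β - 1 ≠ 0 := by linarith
  rcases lt_trichotomy t 0 with ht | rfl | ht
  · rw [max_eq_right ht.le, zero_rpow hβ1, mul_zero]
    refine (hasDerivAt_const t (0 : ℝ)).congr_of_eventuallyEq ?_
    filter_upwards [Iio_mem_nhds ht] with x hx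
    rw [max_eq_right (Set.mem_Iio.1 hx).le, zero_rpow hβ0]
  · rw [max_self, ← hasDerivWithinAt_univ, ← Set.Iic_union_Ici (a := (0 : ℝ))]
    refine HasDerivWithinAt.union ?_ ?_
    · rw [zero_rpow hβ1, mul_zero]
      refine (hasDerivWithinAt_const (0 : ℝ) (Set.Iic 0) (0 : ℝ)).congr (fun x hx => ?_) ?_
      · rw [max_eq_right (Set.mem_Iic.1 hx), zero_rpow hβ0]
      · rw [max_self, zero_rpow hβ0]
    · refine (Real.hasDerivAt_rpow_const (Or.inr hβ.le)).hasDerivWithinAt.congr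
        (fun x hx => ?_) ?_
      · rw [max_eq_left (Set.mem_Ici.1 hx)]
      · rw [max_self]
  · rw [max_eq_left ht.le]
    refine (Real.hasDerivAt_rpow_const (Or.inr hβ.le)).congr_of_eventuallyEq ?_
    filter_upwards [Ioi_mem_nhds ht] with x hx
    rw [max_eq_left (Set.mem_Ioi.1 hx).le]

lemma contDiff_max_zero_rpow {β : ℝ} (hβ : 1 < β) :
    ContDiff ℝ 1 (fun t : ℝ => (max t 0) ^ β) := by
  rw [contDiff_one_iff_deriv]
  refine ⟨fun t => (hasDerivAt_max_zero_rpow hβ t).differentiableAt, ?_⟩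
  have : deriv (fun t : ℝ => (max t 0) ^ β) = fun t => β * (max t 0) ^ (β - 1) :=
    funext fun t => (hasDerivAt_max_zero_rpow hβ t).deriv
  rw [this]
  exact continuous_const.mul
    ((continuous_id.max continuous_const).rpow_const fun _ => Or.inr (by linarith))

section Domain

variable {N : ℕ} {Ω : Set (EuclideanSpace ℝ (Fin N))}

lemma Continuous.integrableOn_of_isBounded (hΩbdd : Bornology.IsBounded Ω)
    {f : EuclideanSpace ℝ (Fin N) → ℝ} (hf : Continuous f) : IntegrableOn f Ω :=
  (hf.continuousOn.integrableOn_compact hΩbdd.isCompact_closure).mono_set subset_closure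

lemma contDiff_fderiv_apply {n m : WithTop ℕ∞} (hnm : n + 1 ≤ m)
    {f : EuclideanSpace ℝ (Fin N) → ℝ} (hf : ContDiff ℝ m f) (v : EuclideanSpace ℝ (Fin N)) :
    ContDiff ℝ n (fun x => fderiv ℝ f x v) :=
  (hf.fderiv_right hnm).clm_apply contDiff_const

lemma contDiff_lap {n m : WithTop ℕ∞} (hnm : n + 1 + 1 ≤ m)
    {f : EuclideanSpace ℝ (Fin N) → ℝ} (hf : ContDiff ℝ m f) : ContDiff ℝ n (lap f) :=
  ContDiff.sum fun i _ => contDiff_fderiv_apply le_rfl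
    (contDiff_fderiv_apply hnm hf (EuclideanSpace.single i 1)) _

lemma lap_const_mul {f : EuclideanSpace ℝ (Fin N) → ℝ} (hf : ContDiff ℝ 2 f) (c : ℝ)
    (x : EuclideanSpace ℝ (Fin N)) : lap (fun y => c * f y) x = c * lap f x := by
  have hf1 : Differentiable ℝ f := hf.differentiable (by norm_num)
  have hf2 (v) : Differentiable ℝ (fun y => fderiv ℝ f y v) :=
    (contDiff_fderiv_apply (n := 1) (by norm_num) hf v).differentiable (by norm_num)
  simp only [lap, Finset.mul_sum]
  refine Finset.sum_congr rfl fun i _ => ?_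
  have : (fun y => fderiv ℝ (fun y => c * f y) y (EuclideanSpace.single i 1)) =
      fun y => c * fderiv ℝ f y (EuclideanSpace.single i 1) := by
    funext y
    rw [fderiv_const_mul (hf1 y)]
    simp
  rw [this, fderiv_const_mul (hf2 _ x)]
  simp

lemma lap_nonneg_of_isLocalMin {f : EuclideanSpace ℝ (Fin N) → ℝ} (hf : ContDiff ℝ 2 f)
    {x : EuclideanSpace ℝ (Fin N)} (hx : IsLocalMin f x) : 0 ≤ lap f x := by
  refine Finset.sum_nonneg fun i _ => ?_
  set v : EuclideanSpace ℝ (Fin N) := EuclideanSpace.single i 1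
  have hline (t : ℝ) : HasDerivAt (fun t : ℝ => x + t • v) v t := by
    simpa using ((hasDerivAt_id t).smul_const v).const_add x
  have hf1 : Differentiable ℝ f := hf.differentiable (by norm_num)
  have hf2 : Differentiable ℝ (fun y => fderiv ℝ f y v) :=
    (contDiff_fderiv_apply (n := 1) (by norm_num) hf v).differentiable (by norm_num)
  set g : ℝ → ℝ := fun t => f (x + t • v)
  have hg1 : deriv g = fun t => fderiv ℝ f (x + t • v) v := funext fun t =>
    ((hf1 _).hasFDerivAt.comp_hasDerivAt t (hline t)).deriv
  have hg2 : deriv (deriv g) 0 = fderiv ℝ (fun y => fderiv ℝ f y v) x v := by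
    rw [hg1]
    have h := ((hf2 (x + (0 : ℝ) • v)).hasFDerivAt.comp_hasDerivAt (0 : ℝ) (hline 0)).deriv
    rw [zero_smul, add_zero] at h
    exact h
  have hgc : Continuous g := hf.continuous.comp (by fun_prop)
  have hmin : IsLocalMin g 0 := by
    have h0 : Tendsto (fun t : ℝ => x + t • v) (𝓝 0) (𝓝 x) := by
      have : Continuous fun t : ℝ => x + t • v := by fun_prop
      simpa using this.tendsto 0
    have : ∀ᶠ t in 𝓝 (0 : ℝ), f x ≤ f (x + t • v) := h0.eventually hx
    filter_upwards [this] with t ht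
    simpa [g] using ht
  rw [← hg2]
  by_contra! hneg
  have hmax := isLocalMax_of_deriv_deriv_neg hneg hmin.deriv_eq_zero hgc.continuousAt
  have hconst : g =ᶠ[𝓝 0] fun _ => g 0 := by
    filter_upwards [hmin, hmax] with t h1 h2 using le_antisymm h2 h1
  have h1 : deriv g =ᶠ[𝓝 0] fun _ => 0 := by
    simpa using hconst.deriv
  have h2 : deriv (deriv g) 0 = 0 := by
    simpa using h1.deriv_eq
  linarith

/-- Weak maximum principle for strictly superharmonic functions. -/
lemma nonneg_of_lap_neg (hΩopen : IsOpen Ω) (hΩbdd : Bornology.IsBounded Ω)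
    {f : EuclideanSpace ℝ (Fin N) → ℝ} (hf : ContDiff ℝ 2 f) (hlap : ∀ x ∈ Ω, lap f x < 0)
    (hbd : ∀ x ∈ frontier Ω, f x = 0) {x : EuclideanSpace ℝ (Fin N)} (hx : x ∈ closure Ω) :
    0 ≤ f x := by
  obtain ⟨y, hy, hmin⟩ := hΩbdd.isCompact_closure.exists_isMinOn ⟨x, hx⟩ hf.continuous.continuousOn
  refine le_trans ?_ (hmin hx)
  by_cases hyΩ : y ∈ Ω
  · have : IsLocalMin f y := hmin.isLocalMin (mem_of_superset (hΩopen.mem_nhds hyΩ) subset_closure)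
    exact absurd (lap_nonneg_of_isLocalMin hf this) (hlap y hyΩ).not_ge
  · exact (hbd y ⟨hy, by rwa [hΩopen.interior_eq]⟩).ge

/-- A truncated power of a function vanishing on the boundary, extended by zero. -/
noncomputable def truncPow (Ω : Set (EuclideanSpace ℝ (Fin N)))
    (w : EuclideanSpace ℝ (Fin N) → ℝ) (ε β : ℝ) : EuclideanSpace ℝ (Fin N) → ℝ :=
  Ω.indicator fun x => (max (w x - ε) 0) ^ β

lemma tsupport_truncPow_subset (hΩopen : IsOpen Ω)
    {w : EuclideanSpace ℝ (Fin N) → ℝ} (hw : Continuous w) (hbd : ∀ x ∈ frontier Ω, w x = 0)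
    {ε β : ℝ} (hε : 0 < ε) (hβ : 1 < β) : tsupport (truncPow Ω w ε β) ⊆ Ω := by
  have hK : IsClosed (closure Ω ∩ {x | ε ≤ w x}) :=
    isClosed_closure.inter (isClosed_le continuous_const hw)
  refine (closure_minimal (fun x hx => ?_) hK).trans fun x hx => ?_
  · have hxΩ : x ∈ Ω := Set.mem_of_indicator_ne_zero hx
    refine ⟨subset_closure hxΩ, ?_⟩
    by_contra! h
    refine hx ?_
    have : w x < ε := not_le.1 h
    rw [truncPow, Set.indicator_of_mem hxΩ, max_eq_right (by linarith), zero_rpow (by linarith)]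
  · by_contra h
    have := hbd x ⟨hx.1, by rwa [hΩopen.interior_eq]⟩
    have := hx.2
    simp only [Set.mem_ofPred_eq] at this
    linarith

lemma hasCompactSupport_truncPow (hΩbdd : Bornology.IsBounded Ω)
    (w : EuclideanSpace ℝ (Fin N) → ℝ) (ε β : ℝ) : HasCompactSupport (truncPow Ω w ε β) :=
  HasCompactSupport.intro' hΩbdd.isCompact_closure isClosed_closure fun _ hx =>
    Set.indicator_of_notMem (fun h => hx (subset_closure h)) _

lemma contDiff_truncPow (hΩopen : IsOpen Ω)
    {w : EuclideanSpace ℝ (Fin N) → ℝ} (hw : ContDiff ℝ 1 w) (hbd : ∀ x ∈ frontier Ω, w x = 0)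
    {ε β : ℝ} (hε : 0 < ε) (hβ : 1 < β) : ContDiff ℝ 1 (truncPow Ω w ε β) := by
  rw [contDiff_iff_contDiffAt]
  intro x
  by_cases hx : x ∈ Ω
  · have h : ContDiff ℝ 1 fun x => (max (w x - ε) 0) ^ β :=
      (contDiff_max_zero_rpow hβ).comp (hw.sub contDiff_const)
    refine h.contDiffAt.congr_of_eventuallyEq ?_
    filter_upwards [hΩopen.mem_nhds hx] with y hy using Set.indicator_of_mem hy _
  · have hx' : x ∉ tsupport (truncPow Ω w ε β) := fun h =>
      hx (tsupport_truncPow_subset hΩopen hw.continuous hbd hε hβ h)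
    exact contDiffAt_const.congr_of_eventuallyEq (notMem_tsupport_iff_eventuallyEq.1 hx')

lemma fderiv_truncPow (hΩopen : IsOpen Ω)
    {w : EuclideanSpace ℝ (Fin N) → ℝ} (hw : Differentiable ℝ w)
    {ε β : ℝ} (hβ : 1 < β) {x : EuclideanSpace ℝ (Fin N)} (hx : x ∈ Ω)
    (v : EuclideanSpace ℝ (Fin N)) :
    fderiv ℝ (truncPow Ω w ε β) x v = β * (max (w x - ε) 0) ^ (β - 1) * fderiv ℝ w x v := by
  have h : truncPow Ω w ε β =ᶠ[𝓝 x] fun y => (max (w y - ε) 0) ^ β := by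
    filter_upwards [hΩopen.mem_nhds hx] with y hy using Set.indicator_of_mem hy _
  have h' := ((hasDerivAt_max_zero_rpow hβ _).comp_hasFDerivAt x
    ((hw x).hasFDerivAt.sub_const ε)).fderiv
  rw [h.fderiv_eq]
  exact congrArg (fun L => L v) h'

/-- Green's formula against a compactly supported function. -/
lemma integral_gradDot_eq {h w : EuclideanSpace ℝ (Fin N) → ℝ} (hh : ContDiff ℝ 1 h)
    (hhc : HasCompactSupport h) (hw : ContDiff ℝ 2 w) :
    ∫ x, gradDot h w x = -∫ x, h x * lap w x := by
  have hdh (v) : Continuous fun x => fderiv ℝ h x v :=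
    (contDiff_fderiv_apply (n := 0) (by norm_num) hh v).continuous
  have hdhc (v) : HasCompactSupport fun x => fderiv ℝ h x v := hhc.fderiv_apply ℝ v
  have hdw (v) : ContDiff ℝ 1 fun x => fderiv ℝ w x v :=
    contDiff_fderiv_apply (by norm_num) hw v
  have hddw (v) : Continuous fun x => fderiv ℝ (fun y => fderiv ℝ w y v) x v :=
    (contDiff_fderiv_apply (n := 0) (by norm_num) (hdw v) v).continuous
  have h1 (v : EuclideanSpace ℝ (Fin N)) :
      Integrable fun x => fderiv ℝ h x v * fderiv ℝ w x v :=
    ((hdh v).mul (hdw v).continuous).integrable_of_hasCompactSupport (hdhc v).mul_right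
  have h2 (v : EuclideanSpace ℝ (Fin N)) :
      Integrable fun x => h x * fderiv ℝ (fun y => fderiv ℝ w y v) x v :=
    (hh.continuous.mul (hddw v)).integrable_of_hasCompactSupport hhc.mul_right
  have h3 (v : EuclideanSpace ℝ (Fin N)) : Integrable fun x => h x * fderiv ℝ w x v :=
    (hh.continuous.mul (hdw v).continuous).integrable_of_hasCompactSupport hhc.mul_right
  simp only [gradDot, lap, Finset.mul_sum]
  rw [integral_finsetSum _ fun i _ => h1 _, integral_finsetSum _ fun i _ => h2 _,
    ← Finset.sum_neg_distrib]
  refine Finset.sum_congr rfl fun i _ => ?_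
  rw [integral_mul_fderiv_eq_neg_fderiv_mul_of_integrable (h1 _) (h2 _) (h3 _)
    (fun x _ => hh.differentiable (by norm_num) x)
    (fun x _ => (hdw _).differentiable (by norm_num) x), neg_neg]

lemma norm_normed_convolution_le (ρ : ContDiffBump (0 : EuclideanSpace ℝ (Fin N)))
    {g : EuclideanSpace ℝ (Fin N) → ℝ} (hg : Continuous g) {M : ℝ} (hM : ∀ x, ‖g x‖ ≤ M)
    (x : EuclideanSpace ℝ (Fin N)) :
    ‖convolution (ρ.normed volume) g (ContinuousLinearMap.lsmul ℝ ℝ) volume x‖ ≤ 3 * M := by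
  have h := ρ.dist_normed_convolution_le (μ := volume) (x₀ := x) (ε := 2 * M)
    hg.aestronglyMeasurable fun y _ => by
      rw [dist_eq_norm]
      linarith [norm_sub_le (g y) (g x), hM x, hM y]
  rw [dist_eq_norm] at h
  linarith [norm_le_norm_add_norm_sub'
    (convolution (ρ.normed volume) g (ContinuousLinearMap.lsmul ℝ ℝ) volume x) (g x), hM x]

lemma fderiv_normed_convolution (ρ : ContDiffBump (0 : EuclideanSpace ℝ (Fin N)))
    {g : EuclideanSpace ℝ (Fin N) → ℝ} (hg : ContDiff ℝ 1 g) (hgc : HasCompactSupport g)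
    (x v : EuclideanSpace ℝ (Fin N)) :
    fderiv ℝ (convolution (ρ.normed volume) g (ContinuousLinearMap.lsmul ℝ ℝ) volume) x v =
      convolution (ρ.normed volume) (fun y => fderiv ℝ g y v)
        (ContinuousLinearMap.lsmul ℝ ℝ) volume x := by
  have hρ : LocallyIntegrable (ρ.normed volume) :=
    (ρ.continuous_normed (μ := volume)).locallyIntegrable
  rw [(hgc.hasFDerivAt_convolution_right (ContinuousLinearMap.lsmul ℝ ℝ) hρ hg x).fderiv]
  exact convolution_precompR_apply _ hρ (hgc.fderiv ℝ) (hg.continuous_fderiv one_ne_zero) x v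

/-- A quadratic-form inequality valid for smooth test functions extends to `C¹` test functions. -/
lemma stability_of_contDiff_one (hΩopen : IsOpen Ω) (hΩbdd : Bornology.IsBounded Ω)
    {W : EuclideanSpace ℝ (Fin N) → ℝ} (hW : Continuous W) {κ : ℝ}
    (hstab : ∀ φ : EuclideanSpace ℝ (Fin N) → ℝ, ContDiff ℝ (⊤ : ℕ∞) φ →
      HasCompactSupport φ → tsupport φ ⊆ Ω →
      κ * ∫ x in Ω, W x * φ x ^ 2 ≤ ∫ x in Ω, gradDot φ φ x)
    {φ : EuclideanSpace ℝ (Fin N) → ℝ} (hφ : ContDiff ℝ 1 φ) (hφc : HasCompactSupport φ)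
    (hφΩ : tsupport φ ⊆ Ω) :
    κ * ∫ x in Ω, W x * φ x ^ 2 ≤ ∫ x in Ω, gradDot φ φ x := by
  obtain ⟨δ, hδ, hδΩ⟩ := hφc.isCompact.exists_cthickening_subset_open hΩopen hφΩ
  have hr (n : ℕ) : 0 < δ / (n + 1) := by positivity
  let ρ (n : ℕ) : ContDiffBump (0 : EuclideanSpace ℝ (Fin N)) :=
    ⟨δ / (n + 1) / 2, δ / (n + 1), half_pos (hr n), half_lt_self (hr n)⟩
  have hρ0 : Tendsto (fun n => (ρ n).rOut) atTop (𝓝 0) := by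
    have := (tendsto_one_div_add_atTop_nhds_zero_nat (𝕜 := ℝ)).const_mul δ
    simpa [ρ, div_eq_mul_inv] using this
  let m (g : EuclideanSpace ℝ (Fin N) → ℝ) (n : ℕ) : EuclideanSpace ℝ (Fin N) → ℝ :=
    convolution ((ρ n).normed volume) g (ContinuousLinearMap.lsmul ℝ ℝ) volume
  have hlim {g : EuclideanSpace ℝ (Fin N) → ℝ} (hg : Continuous g) (x) :
      Tendsto (fun n => m g n x) atTop (𝓝 (g x)) :=
    ContDiffBump.convolution_tendsto_right_of_continuous hρ0 hg x
  have hsmooth {g : EuclideanSpace ℝ (Fin N) → ℝ} (hg : Continuous g) (n) :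
      ContDiff ℝ (⊤ : ℕ∞) (m g n) :=
    (ρ n).hasCompactSupport_normed.contDiff_convolution_left _ (ρ n).contDiff_normed
      hg.locallyIntegrable
  have hbound {g : EuclideanSpace ℝ (Fin N) → ℝ} (hg : Continuous g) (hgc : HasCompactSupport g) :
      ∃ M : ℝ, 0 ≤ M ∧ ∀ n x, ‖m g n x‖ ≤ M := by
    obtain ⟨M, hM⟩ := hgc.exists_bound_of_continuous hg
    exact ⟨3 * M, by linarith [(norm_nonneg _).trans (hM 0)],
      fun n x => norm_normed_convolution_le (ρ n) hg hM x⟩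
  have hsupp (n : ℕ) : tsupport (m φ n) ⊆ Metric.cthickening δ (tsupport φ) := by
    refine closure_minimal (fun x hx => ?_) Metric.isClosed_cthickening
    obtain ⟨a, ha, b, hb, rfl⟩ := support_convolution_subset _ hx
    rw [ContDiffBump.support_normed_eq, mem_ball_zero_iff] at ha
    refine Metric.mem_cthickening_of_dist_le _ b _ _ (subset_closure hb) ?_
    rw [dist_eq_norm, add_sub_cancel_right]
    refine ha.le.trans (div_le_self hδ.le ?_)
    linarith [(Nat.cast_nonneg n : (0 : ℝ) ≤ n)]
  have hdφ (v) : Continuous fun x => fderiv ℝ φ x v :=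
    (contDiff_fderiv_apply (n := 0) (by norm_num) hφ v).continuous
  have key (n : ℕ) : κ * ∫ x in Ω, W x * m φ n x ^ 2 ≤
      ∫ x in Ω, ∑ i : Fin N,
        m (fun y => fderiv ℝ φ y (EuclideanSpace.single i 1)) n x ^ 2 := by
    refine (hstab _ (hsmooth hφ.continuous n)
      (hφc.isCompact.cthickening.of_isClosed_subset (isClosed_tsupport _) (hsupp n))
      ((hsupp n).trans hδΩ)).trans_eq ?_
    refine integral_congr_ae (Eventually.of_forall fun x => ?_)
    refine Finset.sum_congr rfl fun i _ => ?_
    simp only [m]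
    rw [fderiv_normed_convolution (ρ n) hφ hφc, sq]
  have hsq {a b : ℝ} (hab : ‖a‖ ≤ b) : ‖a ^ 2‖ ≤ b ^ 2 := by
    rw [norm_pow]
    exact pow_le_pow_left₀ (norm_nonneg _) hab 2
  have hleft : Tendsto (fun n => κ * ∫ x in Ω, W x * m φ n x ^ 2) atTop
      (𝓝 (κ * ∫ x in Ω, W x * φ x ^ 2)) := by
    obtain ⟨M, -, hM⟩ := hbound hφ.continuous hφc
    refine (tendsto_integral_of_dominated_convergence (fun x => ‖W x‖ * M ^ 2) (fun n => ?_)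
      ((hW.norm.mul continuous_const).integrableOn_of_isBounded hΩbdd).integrable
      (fun n => ?_) ?_).const_mul κ
    · exact (hW.mul ((hsmooth hφ.continuous n).continuous.pow 2)).aestronglyMeasurable
    · refine Eventually.of_forall fun x => ?_
      rw [norm_mul]
      exact mul_le_mul_of_nonneg_left (hsq (hM n x)) (norm_nonneg _)
    · exact Eventually.of_forall fun x => ((hlim hφ.continuous x).pow 2).const_mul _
  have hright : Tendsto (fun n => ∫ x in Ω, ∑ i : Fin N,
      m (fun y => fderiv ℝ φ y (EuclideanSpace.single i 1)) n x ^ 2) atTop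
      (𝓝 (∫ x in Ω, gradDot φ φ x)) := by
    choose M _ hM using fun i : Fin N =>
      hbound (hdφ (EuclideanSpace.single i 1)) (hφc.fderiv_apply ℝ _)
    refine tendsto_integral_of_dominated_convergence (fun _ => ∑ i, M i ^ 2) (fun n => ?_)
      (continuous_const.integrableOn_of_isBounded hΩbdd).integrable (fun n => ?_) ?_
    · exact (continuous_finsetSum _ fun i _ =>
        (hsmooth (hdφ _) n).continuous.pow 2).aestronglyMeasurable
    · exact Eventually.of_forall fun x =>
        norm_sum_le_of_le _ fun i _ => hsq (hM i n x)
    · refine Eventually.of_forall fun x => ?_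
      simp only [gradDot, ← sq]
      exact tendsto_finsetSum _ fun i _ => (hlim (hdφ _) x).pow 2
  exact le_of_tendsto_of_tendsto' hleft hright key

lemma tendsto_integral_mul_truncPow (hΩbdd : Bornology.IsBounded Ω)
    {F w : EuclideanSpace ℝ (Fin N) → ℝ} (hF : Continuous F) (hw : Continuous w)
    (hw0 : ∀ x ∈ Ω, 0 ≤ w x) (hΩ : MeasurableSet Ω) {β : ℝ} (hβ : 0 ≤ β) :
    Tendsto (fun ε => ∫ x in Ω, F x * (max (w x - ε) 0) ^ β) (𝓝[>] 0)
      (𝓝 (∫ x in Ω, F x * w x ^ β)) := by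
  refine tendsto_integral_filter_of_dominated_convergence (fun x => ‖F x * w x ^ β‖)
    (Eventually.of_forall fun ε => ?_) ?_ ?_ ?_
  · exact (hF.mul (((hw.sub continuous_const).max continuous_const).rpow_const
      fun _ => Or.inr hβ)).aestronglyMeasurable
  · filter_upwards [self_mem_nhdsWithin] with ε hε
    filter_upwards [ae_restrict_mem hΩ] with x hx
    rw [norm_mul, norm_mul]
    refine mul_le_mul_of_nonneg_left ?_ (norm_nonneg _)
    have h1 : (0 : ℝ) ≤ max (w x - ε) 0 := le_max_right _ _
    rw [norm_of_nonneg (rpow_nonneg h1 _), norm_of_nonneg (rpow_nonneg (hw0 x hx) _)]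
    exact rpow_le_rpow h1 (max_le (by linarith [Set.mem_Ioi.1 hε]) (hw0 x hx)) hβ
  · exact ((hF.mul (hw.rpow_const fun _ => Or.inr hβ)).norm).integrableOn_of_isBounded hΩbdd
  · filter_upwards [ae_restrict_mem hΩ] with x hx
    have hc : Continuous fun ε : ℝ => F x * (max (w x - ε) 0) ^ β :=
      continuous_const.mul (((continuous_const.sub continuous_id).max continuous_const).rpow_const
        fun _ => Or.inr hβ)
    have := (hc.tendsto 0).mono_left (nhdsWithin_le_nhds (s := Set.Ioi 0))
    simpa [max_eq_left (hw0 x hx)] using this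

/-- Testing the stability inequality with a power of a function vanishing on the boundary. -/
lemma stability_rpow (hΩopen : IsOpen Ω) (hΩbdd : Bornology.IsBounded Ω)
    {W : EuclideanSpace ℝ (Fin N) → ℝ} (hW : Continuous W) {κ : ℝ}
    (hstab : ∀ φ : EuclideanSpace ℝ (Fin N) → ℝ, ContDiff ℝ (⊤ : ℕ∞) φ →
      HasCompactSupport φ → tsupport φ ⊆ Ω →
      κ * ∫ x in Ω, W x * φ x ^ 2 ≤ ∫ x in Ω, gradDot φ φ x)
    {w : EuclideanSpace ℝ (Fin N) → ℝ} (hw : ContDiff ℝ 2 w) (hw0 : ∀ x ∈ Ω, 0 ≤ w x)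
    (hbd : ∀ x ∈ frontier Ω, w x = 0) {β : ℝ} (hβ : 2 < β) :
    κ * ∫ x in Ω, W x * w x ^ β ≤
      β ^ 2 / (4 * (β - 1)) * ∫ x in Ω, (-lap w x) * w x ^ (β - 1) := by
  have hw1 : ContDiff ℝ 1 w := hw.of_le (by norm_num)
  have hlapc : Continuous fun x => -lap w x := (contDiff_lap (n := 0) (by norm_num) hw).continuous.neg
  refine le_of_tendsto_of_tendsto
    ((tendsto_integral_mul_truncPow hΩbdd hW hw.continuous hw0 hΩopen.measurableSet
      (by linarith : 0 ≤ β)).const_mul κ)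
    ((tendsto_integral_mul_truncPow hΩbdd hlapc hw.continuous hw0 hΩopen.measurableSet
      (by linarith : 0 ≤ β - 1)).const_mul _) ?_
  filter_upwards [self_mem_nhdsWithin] with ε hε
  have hε : 0 < ε := hε
  have hpos (x) : (0 : ℝ) ≤ max (w x - ε) 0 := le_max_right _ _
  have h := stability_of_contDiff_one hΩopen hΩbdd hW hstab
    (contDiff_truncPow hΩopen hw1 hbd hε (by linarith : 1 < β / 2))
    (hasCompactSupport_truncPow hΩbdd w ε (β / 2))
    (tsupport_truncPow_subset hΩopen hw.continuous hbd hε (by linarith))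
  have hgreen := integral_gradDot_eq
    (contDiff_truncPow hΩopen hw1 hbd hε (by linarith : 1 < β - 1))
    (hasCompactSupport_truncPow hΩbdd w ε (β - 1)) hw
  have hl : ∫ x in Ω, W x * truncPow Ω w ε (β / 2) x ^ 2 =
      ∫ x in Ω, W x * (max (w x - ε) 0) ^ β := by
    refine setIntegral_congr_fun hΩopen.measurableSet fun x hx => ?_
    simp only [truncPow, Set.indicator_of_mem hx]
    rw [← rpow_natCast, ← rpow_mul (hpos x)]
    norm_num
  have hr : ∫ x in Ω, gradDot (truncPow Ω w ε (β / 2)) (truncPow Ω w ε (β / 2)) x =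
      β ^ 2 / (4 * (β - 1)) * ∫ x in Ω, gradDot (truncPow Ω w ε (β - 1)) w x := by
    rw [← integral_const_mul]
    refine setIntegral_congr_fun hΩopen.measurableSet fun x hx => ?_
    simp only [gradDot, Finset.mul_sum]
    refine Finset.sum_congr rfl fun i _ => ?_
    rw [fderiv_truncPow hΩopen (hw1.differentiable (by norm_num)) (by linarith) hx,
      fderiv_truncPow hΩopen (hw1.differentiable (by norm_num)) (by linarith) hx]
    have : (max (w x - ε) 0) ^ (β - 1 - 1) =
        (max (w x - ε) 0) ^ (β / 2 - 1) * (max (w x - ε) 0) ^ (β / 2 - 1) := by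
      rw [← rpow_add_of_nonneg (hpos x) (by linarith) (by linarith)]
      congr 1
      ring
    rw [this]
    have : β - 1 ≠ 0 := by linarith
    field_simp
    ring
  have hg1 : ∫ x in Ω, gradDot (truncPow Ω w ε (β - 1)) w x =
      ∫ x, gradDot (truncPow Ω w ε (β - 1)) w x := by
    refine setIntegral_eq_integral_of_forall_compl_eq_zero fun x hx => ?_
    have hx' : x ∉ tsupport (truncPow Ω w ε (β - 1)) := fun h =>
      hx (tsupport_truncPow_subset hΩopen hw.continuous hbd hε (by linarith) h)
    have hz : fderiv ℝ (truncPow Ω w ε (β - 1)) x = 0 := by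
      rw [(notMem_tsupport_iff_eventuallyEq.1 hx').fderiv_eq]
      exact fderiv_const_apply (0 : ℝ)
    simp [gradDot, hz]
  have hg2 : -∫ x, truncPow Ω w ε (β - 1) x * lap w x =
      ∫ x in Ω, (-lap w x) * (max (w x - ε) 0) ^ (β - 1) := by
    rw [← integral_neg, ← setIntegral_eq_integral_of_forall_compl_eq_zero (s := Ω)]
    · refine setIntegral_congr_fun hΩopen.measurableSet fun x hx => ?_
      simp only [truncPow, Set.indicator_of_mem hx]
      ring
    · intro x hx
      simp [truncPow, Set.indicator_of_notMem hx]
  rwa [hl, hr, hg1, hgreen, hg2] at h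

end Domain

/-- The quartic `Lpoly p` is negative between `2` and any of its larger roots. -/
lemma Lpoly_neg {p s s₀ : ℝ} (hp : 1 < p) (hs2 : 2 ≤ s) (hss₀ : s < s₀)
    (hroot : Lpoly p s₀ = 0) : Lpoly p s < 0 := by
  obtain ⟨x, hx⟩ : ∃ x, x = p / (p + 1) := ⟨_, rfl⟩
  have hp1 : 0 < p + 1 := by linarith
  have hx1 : 1 / 2 < x := by rw [hx, div_lt_div_iff₀ two_pos hp1]; linarith
  have hL (r : ℝ) : Lpoly p r = (r - 2) ^ 4 + 8 * (r - 2) ^ 3 + (24 - 32 * x) * (r - 2) ^ 2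
      - 32 * (2 * x - 1) * (x + 1) * (r - 2) - 16 * (4 * x ^ 2 - 1) := by
    simp only [Lpoly, hx]
    field_simp
    ring
  rw [hL] at hroot ⊢
  obtain ⟨a, ha, ha0⟩ : ∃ a, a = 16 * (4 * x ^ 2 - 1) ∧ 0 < a := ⟨_, rfl, by nlinarith⟩
  obtain ⟨b, hb, hb0⟩ : ∃ b, b = 32 * (2 * x - 1) * (x + 1) ∧ 0 < b :=
    ⟨_, rfl, by nlinarith⟩
  rw [← ha, ← hb] at hroot ⊢
  obtain ⟨h, hh⟩ : ∃ h, h = s - 2 := ⟨_, rfl⟩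
  obtain ⟨k, hk⟩ : ∃ k, k = s₀ - 2 := ⟨_, rfl⟩
  rw [← hk] at hroot
  rw [← hh]
  have hh0 : 0 ≤ h := by linarith
  have hhk : h < k := by linarith
  have hk0 : 0 < k := by linarith
  rcases hh0.eq_or_lt with rfl | hh0
  · simpa using ha0
  · have e : (h ^ 4 + 8 * h ^ 3 + (24 - 32 * x) * h ^ 2 - b * h - a) * k ^ 2 =
        -((k - h) * (h ^ 2 * k ^ 2 * (h + k) + 8 * h ^ 2 * k ^ 2 + b * h * k + a * (h + k))) := by
      linear_combination h ^ 2 * hroot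
    have : 0 < (k - h) *
        (h ^ 2 * k ^ 2 * (h + k) + 8 * h ^ 2 * k ^ 2 + b * h * k + a * (h + k)) :=
      mul_pos (by linarith) (by positivity)
    by_contra! hn
    nlinarith [mul_nonneg hn (sq_nonneg k)]

lemma mul_lt_of_Lpoly_neg {p s : ℝ} (hp : 1 < p) (hs : 2 < s) (hL : Lpoly p s < 0) :
    ((p + 1) * s / 2) ^ 2 / (4 * ((p + 1) * s / 2 - 1)) * (s ^ 2 / (4 * (s - 1))) < p := by
  have hp1 : 0 < p + 1 := by linarith
  have hm : 0 < (p + 1) * s / 2 - 1 := by nlinarith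
  have hs1 : 0 < s - 1 := by linarith
  have e : Lpoly p s * (p + 1) ^ 2 =
      (p + 1) ^ 2 * s ^ 4 - 64 * p * ((p + 1) * s / 2 - 1) * (s - 1) := by
    simp only [Lpoly]
    field_simp
    ring
  have h : (p + 1) ^ 2 * s ^ 4 < 64 * p * ((p + 1) * s / 2 - 1) * (s - 1) := by
    nlinarith [mul_neg_of_neg_of_pos hL (pow_pos hp1 2)]
  rw [div_mul_div_comm, div_lt_iff₀ (by positivity)]
  nlinarith

/-- Young's inequality with conjugate exponents `s` and `s / (s - 1)`. -/
lemma mul_rpow_sub_one_le {a b s : ℝ} (ha : 0 ≤ a) (hb : 0 ≤ b) (hs : 1 < s) :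
    a * b ^ (s - 1) ≤ a ^ s / s + (s - 1) / s * b ^ s := by
  have hs0 : s ≠ 0 := by linarith
  have h := geom_mean_le_arith_mean2_weighted (w₁ := 1 / s) (w₂ := (s - 1) / s)
    (by positivity) (div_nonneg (by linarith) (by linarith)) (rpow_nonneg ha s)
    (rpow_nonneg hb s) (by field_simp; ring)
  rw [← rpow_mul ha, ← rpow_mul hb, mul_one_div_cancel hs0, rpow_one,
    mul_div_cancel₀ _ hs0] at h
  linarith [one_div_mul_eq_div s (a ^ s)]

/-- Replacing `u` by `u + 1` in a weighted power costs a small multiple of it plus a constant. -/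
lemma exists_weighted_rpow_add_one_le {c m ε : ℝ} (hc : 0 ≤ c) (hm : 0 ≤ m) (hε : 0 < ε) :
    ∃ K : ℝ, 0 ≤ K ∧ ∀ u : ℝ, 0 ≤ u →
      (u + 1) ^ c * (u + 1) ^ m ≤ (1 + ε) * ((u + 1) ^ c * u ^ m) + K := by
  have hlim : Tendsto (fun u : ℝ => (1 + u⁻¹) ^ m) atTop (𝓝 1) := by
    have h : Tendsto (fun u : ℝ => 1 + u⁻¹) atTop (𝓝 1) := by
      simpa using tendsto_inv_atTop_zero.const_add (1 : ℝ)
    simpa using h.rpow_const (p := m) (Or.inl one_ne_zero)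
  obtain ⟨M, hM⟩ := eventually_atTop.1
    ((hlim.eventually_lt_const (by linarith : 1 < 1 + ε)).and (eventually_gt_atTop 0))
  have hM0 : 0 < M := (hM M le_rfl).2
  refine ⟨(M + 1) ^ c * (M + 1) ^ m, by positivity, fun u hu => ?_⟩
  rcases le_total M u with h | h
  · obtain ⟨h1, h2⟩ := hM u h
    have e : (u + 1) ^ m = (1 + u⁻¹) ^ m * u ^ m := by
      rw [← mul_rpow (by positivity) hu]
      congr 1
      field_simp
    rw [e]
    have h3 : 0 ≤ (u + 1) ^ c * u ^ m := by positivity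
    have h4 : 0 ≤ (M + 1) ^ c * (M + 1) ^ m := by positivity
    nlinarith [mul_le_mul_of_nonneg_right h1.le h3]
  · have h1 : (u + 1) ^ c * (u + 1) ^ m ≤ (M + 1) ^ c * (M + 1) ^ m := by gcongr
    have h2 : 0 ≤ (1 + ε) * ((u + 1) ^ c * u ^ m) := by positivity
    linarith

lemma weighted_rpow_le_of_le {c a b u : ℝ} (hc : 0 ≤ c) (ha : 0 ≤ a) (hab : a ≤ b)
    (hu : 0 ≤ u) : (u + 1) ^ c * u ^ a ≤ (u + 1) ^ c * u ^ b + 2 ^ c := by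
  rcases le_total 1 u with h | h
  · have : (u + 1) ^ c * u ^ a ≤ (u + 1) ^ c * u ^ b := by
      gcongr
    linarith [rpow_nonneg (zero_le_two : (0 : ℝ) ≤ 2) c]
  · have h1 : (u + 1) ^ c * u ^ a ≤ 2 ^ c * 1 := by
      gcongr
      · linarith
      · exact rpow_le_one hu h ha
    have : 0 ≤ (u + 1) ^ c * u ^ b := by positivity
    linarith

/-- The a priori bound for exponents `s > 2` at which the quartic is negative. -/
lemma uniform_bound_of_Lpoly_neg {N : ℕ} {Ω : Set (EuclideanSpace ℝ (Fin N))}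
    (hΩopen : IsOpen Ω) (hΩbdd : Bornology.IsBounded Ω) {p s : ℝ} (hp : 1 < p) (hs : 2 < s)
    (hL : Lpoly p s < 0) :
    ∃ C : ℝ, 0 ≤ C ∧ ∀ lam : ℝ, 0 < lam →
      ∀ u : EuclideanSpace ℝ (Fin N) → ℝ, ContDiff ℝ 4 u →
        (∀ x ∈ closure Ω, 0 ≤ u x) →
        (∀ x ∈ Ω, lap (lap u) x = lam * (u x + 1) ^ p) →
        (∀ x ∈ frontier Ω, u x = 0 ∧ lap u x = 0) →
        (∀ φ : EuclideanSpace ℝ (Fin N) → ℝ, ContDiff ℝ (⊤ : ℕ∞) φ →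
          HasCompactSupport φ → tsupport φ ⊆ Ω →
          Real.sqrt (lam * p) * ∫ x in Ω, (u x + 1) ^ ((p - 1) / 2) * φ x ^ 2
            ≤ ∫ x in Ω, gradDot φ φ x) →
        ∫ x in Ω, (u x + 1) ^ ((p - 1) / 2) * u x ^ ((p + 1) * s / 2) ≤ C := by
  have hkp := mul_lt_of_Lpoly_neg hp hs hL
  set m : ℝ := (p + 1) * s / 2 with hm
  have hm2 : 2 < m := by nlinarith
  set c : ℝ := (p - 1) / 2 with hc
  have hc0 : 0 ≤ c := by rw [hc]; linarith
  set k₁ : ℝ := m ^ 2 / (4 * (m - 1))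
  set k₂ : ℝ := s ^ 2 / (4 * (s - 1))
  have hk₁ : 0 < k₁ := div_pos (by positivity) (by linarith)
  have hk₂ : 0 < k₂ := div_pos (by positivity) (by linarith)
  set k : ℝ := √(k₁ * k₂)
  have hk0 : 0 < k := sqrt_pos.2 (mul_pos hk₁ hk₂)
  have hksq : k * k = k₁ * k₂ := mul_self_sqrt (by positivity)
  have hklt : k < √p := sqrt_lt_sqrt (by positivity) hkp
  set η : ℝ := √p - k with hη
  have hη0 : 0 < η := by linarith
  obtain ⟨K, hK0, hK⟩ := exists_weighted_rpow_add_one_le (ε := s * η / (2 * k)) hc0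
    (by linarith : 0 ≤ m) (by positivity)
  refine ⟨2 * k / (s * η) * (K * volume.real Ω), by positivity,
    fun lam hlam u hu hu0 hpde hbd hstab => ?_⟩
  set W : EuclideanSpace ℝ (Fin N) → ℝ := fun x => (u x + 1) ^ c with hWdef
  have hW : Continuous W :=
    (hu.continuous.add continuous_const).rpow_const fun _ => Or.inr hc0
  have hW0 {x} (hx : x ∈ Ω) : 0 ≤ W x :=
    rpow_nonneg (by linarith [hu0 x (subset_closure hx)]) _
  set τ : ℝ := √lam * (k / k₁)
  have hsl : 0 < √lam := sqrt_pos.2 hlam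
  have hτ : 0 < τ := by positivity
  have hlapC : ContDiff ℝ 2 (lap u) := contDiff_lap (by norm_num) hu
  have hlaplap (x) : lap (fun y => -τ⁻¹ * lap u y) x = -τ⁻¹ * lap (lap u) x :=
    lap_const_mul hlapC _ x
  set y : EuclideanSpace ℝ (Fin N) → ℝ := fun x => -τ⁻¹ * lap u x with hy
  have hyC : ContDiff ℝ 2 y := contDiff_const.mul hlapC
  have hybd : ∀ x ∈ frontier Ω, y x = 0 := fun x hx => by simp [hy, (hbd x hx).2]
  have hlapy {x} (hx : x ∈ Ω) : -lap y x = lam / τ * (u x + 1) ^ p := by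
    rw [hlaplap, hpde x hx]
    field_simp
  have hy0 {x} (hx : x ∈ Ω) : 0 ≤ y x := by
    refine nonneg_of_lap_neg hΩopen hΩbdd hyC (fun z hz => ?_) hybd (subset_closure hx)
    have h1 : 0 < u z + 1 := by linarith [hu0 z (subset_closure hz)]
    have : 0 < -lap y z := by rw [hlapy hz]; positivity
    linarith
  have hlapu (x) : -lap u x = τ * y x := by simp only [hy]; field_simp
  have hstab_u := stability_rpow hΩopen hΩbdd hW hstab (hu.of_le (by norm_num))
    (fun x hx => hu0 x (subset_closure hx)) (fun x hx => (hbd x hx).1) hm2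
  have hstab_y := stability_rpow hΩopen hΩbdd hW hstab hyC (fun x hx => hy0 hx) hybd hs
  have hΩint {f : EuclideanSpace ℝ (Fin N) → ℝ} (hf : Continuous f) : IntegrableOn f Ω :=
    hf.integrableOn_of_isBounded hΩbdd
  have hcu {r : ℝ} (hr : 0 ≤ r) : Continuous fun x => u x ^ r :=
    hu.continuous.rpow_const fun _ => Or.inr hr
  have hcu1 {r : ℝ} (hr : 0 ≤ r) : Continuous fun x => (u x + 1) ^ r :=
    (hu.continuous.add continuous_const).rpow_const fun _ => Or.inr hr
  have hcy {r : ℝ} (hr : 0 ≤ r) : Continuous fun x => y x ^ r :=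
    hyC.continuous.rpow_const fun _ => Or.inr hr
  have hAi : IntegrableOn (fun x => W x * u x ^ m) Ω := hΩint (hW.mul (hcu (by linarith)))
  have hAi' : IntegrableOn (fun x => W x * (u x + 1) ^ m) Ω :=
    hΩint (hW.mul (hcu1 (by linarith)))
  have hYi : IntegrableOn (fun x => W x * y x ^ s) Ω := hΩint (hW.mul (hcy (by linarith)))
  set A : ℝ := ∫ x in Ω, W x * u x ^ m
  set A' : ℝ := ∫ x in Ω, W x * (u x + 1) ^ m
  set Y : ℝ := ∫ x in Ω, W x * y x ^ s
  have hY0 : 0 ≤ Y := setIntegral_nonneg hΩopen.measurableSet fun x hx =>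
    mul_nonneg (hW0 hx) (rpow_nonneg (hy0 hx) _)
  have hI₁ : ∫ x in Ω, (-lap u x) * u x ^ (m - 1) ≤ τ * (Y / s + (s - 1) / s * A) := by
    have e : τ * (Y / s + (s - 1) / s * A) =
        ∫ x in Ω, τ * ((W x * y x ^ s) / s + (s - 1) / s * (W x * u x ^ m)) := by
      rw [integral_const_mul, integral_add (hYi.div_const s) (hAi.const_mul _),
        integral_div, integral_const_mul]
    rw [e]
    refine setIntegral_mono_on
      (hΩint ((contDiff_lap (n := 2) (by norm_num) hu).continuous.neg.mul (hcu (by linarith))))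
      (((hYi.div_const s).add (hAi.const_mul _)).const_mul τ) hΩopen.measurableSet
      fun x hx => ?_
    have hux : 0 ≤ u x := hu0 x (subset_closure hx)
    rw [hlapu, mul_assoc]
    refine mul_le_mul_of_nonneg_left ?_ hτ.le
    have h1 : u x ^ (m - 1) ≤ W x * (u x ^ ((p + 1) / 2)) ^ (s - 1) := by
      have : u x ^ (m - 1) = u x ^ c * (u x ^ ((p + 1) / 2)) ^ (s - 1) := by
        rw [← rpow_mul hux, ← rpow_add_of_nonneg hux hc0
          (mul_nonneg (by linarith) (by linarith))]
        congr 1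
        rw [hm, hc]
        ring
      rw [this]
      refine mul_le_mul_of_nonneg_right ?_ (by positivity)
      exact rpow_le_rpow hux (by linarith) hc0
    have h2 := mul_rpow_sub_one_le (hy0 hx) (rpow_nonneg hux ((p + 1) / 2))
      (by linarith : 1 < s)
    rw [← rpow_mul hux ((p + 1) / 2) s, show (p + 1) / 2 * s = m by rw [hm]; ring] at h2
    calc y x * u x ^ (m - 1) ≤ y x * (W x * (u x ^ ((p + 1) / 2)) ^ (s - 1)) :=
          mul_le_mul_of_nonneg_left h1 (hy0 hx)
      _ = W x * (y x * (u x ^ ((p + 1) / 2)) ^ (s - 1)) := by ring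
      _ ≤ W x * (y x ^ s / s + (s - 1) / s * u x ^ m) :=
          mul_le_mul_of_nonneg_left h2 (hW0 hx)
      _ = _ := by ring
  have hI₂ : ∫ x in Ω, (-lap y x) * y x ^ (s - 1) ≤
      lam / τ * (A' / s + (s - 1) / s * Y) := by
    have e : lam / τ * (A' / s + (s - 1) / s * Y) =
        ∫ x in Ω, lam / τ * ((W x * (u x + 1) ^ m) / s + (s - 1) / s * (W x * y x ^ s)) := by
      rw [integral_const_mul, integral_add (hAi'.div_const s) (hYi.const_mul _),
        integral_div, integral_const_mul]
    rw [e]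
    refine setIntegral_mono_on
      (hΩint ((contDiff_lap (n := 0) (by norm_num) hyC).continuous.neg.mul (hcy (by linarith))))
      (((hAi'.div_const s).add (hYi.const_mul _)).const_mul _) hΩopen.measurableSet
      fun x hx => ?_
    have hux : 0 < u x + 1 := by linarith [hu0 x (subset_closure hx)]
    rw [hlapy hx, mul_assoc]
    refine mul_le_mul_of_nonneg_left ?_ (by positivity)
    have h1 : (u x + 1) ^ p = W x * (u x + 1) ^ ((p + 1) / 2) := by
      simp only [hWdef]
      rw [← rpow_add hux]
      congr 1
      rw [hc]
      ring
    have h2 := mul_rpow_sub_one_le (rpow_nonneg hux.le ((p + 1) / 2)) (hy0 hx)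
      (by linarith : 1 < s)
    rw [← rpow_mul hux.le ((p + 1) / 2) s, show (p + 1) / 2 * s = m by rw [hm]; ring] at h2
    calc (u x + 1) ^ p * y x ^ (s - 1)
        = W x * ((u x + 1) ^ ((p + 1) / 2) * y x ^ (s - 1)) := by rw [h1]; ring
      _ ≤ W x * ((u x + 1) ^ m / s + (s - 1) / s * y x ^ s) :=
          mul_le_mul_of_nonneg_left h2 (hW0 hx)
      _ = _ := by ring
  have hA' : A' ≤ (1 + s * η / (2 * k)) * A + K * volume.real Ω := by
    have e : (1 + s * η / (2 * k)) * A + K * volume.real Ω =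
        ∫ x in Ω, ((1 + s * η / (2 * k)) * (W x * u x ^ m) + K) := by
      rw [integral_add (hAi.const_mul _) (hΩint continuous_const), integral_const_mul,
        setIntegral_const, smul_eq_mul, mul_comm K]
    rw [e]
    exact setIntegral_mono_on hAi' ((hAi.const_mul _).add (hΩint continuous_const))
      hΩopen.measurableSet fun x hx => hK _ (hu0 x (subset_closure hx))
  have hsq : √(lam * p) = √lam * √p := sqrt_mul hlam.le p
  have hlam2 : √lam * √lam = lam := mul_self_sqrt hlam.le
  have h₁ : √p * A ≤ k * (Y / s + (s - 1) / s * A) := by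
    have h := hstab_u.trans (mul_le_mul_of_nonneg_left hI₁ hk₁.le)
    have e : k₁ * (τ * (Y / s + (s - 1) / s * A)) =
        √lam * (k * (Y / s + (s - 1) / s * A)) := by
      simp only [τ]
      field_simp
    rw [hsq, mul_assoc, e] at h
    exact le_of_mul_le_mul_left h hsl
  have h₂ : √p * Y ≤ k * (A' / s + (s - 1) / s * Y) := by
    have h := hstab_y.trans (mul_le_mul_of_nonneg_left hI₂ hk₂.le)
    have e : k₂ * (lam / τ * (A' / s + (s - 1) / s * Y)) =
        √lam * (k * (A' / s + (s - 1) / s * Y)) := by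
      have : k₂ * (lam / τ) = √lam * k := by
        simp only [τ]
        rw [← mul_div_assoc, div_eq_iff hτ.ne']
        have e : √lam * k * (√lam * (k / k₁)) = √lam * √lam * (k * k) / k₁ := by ring
        rw [e, hlam2, hksq, eq_div_iff hk₁.ne']
        ring
      rw [← mul_assoc, this, mul_assoc]
    rw [hsq, mul_assoc, e] at h
    exact le_of_mul_le_mul_left h hsl
  have hsum : η * A ≤ k / s * (A' - A) := by
    have e : k * (Y / s + (s - 1) / s * A) + k * (A' / s + (s - 1) / s * Y) =
        k * (A + Y) + k / s * (A' - A) := by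
      field_simp
      ring
    have : 0 ≤ η * Y := by positivity
    rw [hη] at this ⊢
    linarith
  have hfin : η * A ≤ η / 2 * A + k / s * (K * volume.real Ω) := by
    refine hsum.trans ?_
    have : k / s * (A' - A) ≤ k / s * (s * η / (2 * k) * A + K * volume.real Ω) :=
      mul_le_mul_of_nonneg_left (by linarith) (by positivity)
    refine this.trans_eq ?_
    field_simp
  have : η / 2 * A ≤ η / 2 * (2 * k / (s * η) * (K * volume.real Ω)) := by
    have e : η / 2 * (2 * k / (s * η) * (K * volume.real Ω)) = k / s * (K * volume.real Ω) := by
      field_simp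
    rw [e]
    linarith
  exact le_of_mul_le_mul_left this (by positivity)

/-- Uniform integral bound for stable solutions of the Navier problem
`Δ²u = λ(u+1)^p` on a bounded smooth domain `Ω`: for `2 ≤ s < s₀` and
`q = (p+1)s/2 - 1`, the integral `∫_Ω (u+1)^{(p-1)/2} u^{q+1}` is bounded
independently of `λ` and `u`. -/
theorem uniform_bound_minimal_solutions
    (N : ℕ) (hN : 1 ≤ N) (Ω : Set (EuclideanSpace ℝ (Fin N)))
    (hΩopen : IsOpen Ω) (hΩbdd : Bornology.IsBounded Ω)
    (p : ℝ) (hp : 1 < p) (s₀ : ℝ)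
    (hs₀gt : 2 * t0 p < s₀) (hs₀root : Lpoly p s₀ = 0)
    (hs₀uniq : ∀ s : ℝ, 2 * t0 p < s → Lpoly p s = 0 → s = s₀)
    (s : ℝ) (hs2 : 2 ≤ s) (hss₀ : s < s₀) (q : ℝ) (hq : q = (p + 1) * s / 2 - 1) :
    ∃ C : ℝ, 0 < C ∧ ∀ lam : ℝ, 0 < lam →
      ∀ u : EuclideanSpace ℝ (Fin N) → ℝ, ContDiff ℝ 4 u →
        (∀ x ∈ closure Ω, 0 ≤ u x) →
        (∀ x ∈ Ω, lap (lap u) x = lam * (u x + 1) ^ p) →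
        (∀ x ∈ frontier Ω, u x = 0 ∧ lap u x = 0) →
        (∀ φ : EuclideanSpace ℝ (Fin N) → ℝ, ContDiff ℝ (⊤ : ℕ∞) φ →
          HasCompactSupport φ → tsupport φ ⊆ Ω →
          Real.sqrt (lam * p) * ∫ x in Ω, (u x + 1) ^ ((p - 1) / 2) * φ x ^ 2
            ≤ ∫ x in Ω, gradDot φ φ x) →
        ∫ x in Ω, (u x + 1) ^ ((p - 1) / 2) * u x ^ (q + 1) ≤ C := by
  have hs2' : 2 < (s + s₀) / 2 := by linarith
  have hL := Lpoly_neg hp hs2'.le (by linarith : (s + s₀) / 2 < s₀) hs₀root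
  obtain ⟨C, hC0, hC⟩ := uniform_bound_of_Lpoly_neg hΩopen hΩbdd hp hs2' hL
  refine ⟨C + 2 ^ ((p - 1) / 2) * volume.real Ω + 1, by positivity,
    fun lam hlam u hu hu0 hpde hbd hstab => ?_⟩
  have hc0 : 0 ≤ (p - 1) / 2 := by linarith
  have ha0 : 0 ≤ q + 1 := by rw [hq]; nlinarith
  have hab : q + 1 ≤ (p + 1) * ((s + s₀) / 2) / 2 := by rw [hq]; nlinarith
  have hΩint {r : ℝ} (hr : 0 ≤ r) :
      IntegrableOn (fun x => (u x + 1) ^ ((p - 1) / 2) * u x ^ r) Ω :=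
    (((hu.continuous.add continuous_const).rpow_const fun _ => Or.inr hc0).mul
      (hu.continuous.rpow_const fun _ => Or.inr hr)).integrableOn_of_isBounded hΩbdd
  have hconst : IntegrableOn (fun _ : EuclideanSpace ℝ (Fin N) => (2 : ℝ) ^ ((p - 1) / 2)) Ω :=
    continuous_const.integrableOn_of_isBounded hΩbdd
  have h := setIntegral_mono_on (hΩint ha0) ((hΩint (ha0.trans hab)).add hconst)
    hΩopen.measurableSet fun x hx =>
      weighted_rpow_le_of_le hc0 ha0 hab (hu0 x (subset_closure hx))
  simp only [Pi.add_apply] at h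
  rw [integral_add (hΩint (ha0.trans hab)) hconst, setIntegral_const, smul_eq_mul,
    mul_comm (volume.real Ω)] at h
  linarith [hC lam hlam u hu hu0 hpde hbd hstab]
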